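/- Fix a 2k×2k symmetric homogeneous non-negative integer matrix A with tr(A) = 2d, and n+1 variables. The following are equivalent: (i) a general form of degree d in n+1 variables is the sum of s Pfaffians of skew-symmetric 2k×2k matrices of forms, each with degree matrix A; (ii) for a general choice of s skew-symmetric matrices of forms M_1, …, M_s with degree matrix A, the ideal generated by the submaximal Pfaffians of all the M_i coincides, in degree d, with the whole space R_d of forms of degree d. -/

import Mathlib

open MvPolynomial

/-- The Pfaffian of a `2n × 2n` matrix of multivariate polynomials over `ℂ`,
given by the standard averaged signed sum over permutations. -/
noncomputable def pfaff {σ : Type*} {n : ℕ}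
    (M : Matrix (Fin (2*n)) (Fin (2*n)) (MvPolynomial σ ℂ)) : MvPolynomial σ ℂ :=
  (((2^n * n.factorial : ℕ) : ℂ)⁻¹) •
    ∑ p : Equiv.Perm (Fin (2*n)),
      (Equiv.Perm.sign p : ℤ) •
        ∏ i : Fin n, M (p ⟨2*i.1, by have := i.2; omega⟩) (p ⟨2*i.1+1, by have := i.2; omega⟩)

/-- A square matrix of polynomials is skew-symmetric. -/
def IsSkew {m : Type*} {R : Type*} [Ring R] (M : Matrix m m R) : Prop :=
  ∀ i j, M j i = - M i j

/-- A square integer matrix is homogeneous. -/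
def HomogMat {m : Type*} (A : Matrix m m ℕ) : Prop :=
  ∀ i j l r, A i j + A l r = A i r + A l j

/-- A matrix of polynomials has degree matrix `A`. -/
def DegMat {σ m : Type*} (M : Matrix m m (MvPolynomial σ ℂ)) (A : Matrix m m ℕ) : Prop :=
  ∀ i j, (M i j).IsHomogeneous (A i j)

/-- The set of submaximal Pfaffians of a skew-symmetric matrix of even size `2k`:
Pfaffians of the submatrices obtained by erasing two rows and the two columns
with the same indexes. -/
def submaxPfEven {σ : Type*} {k : ℕ}
    (M : Matrix (Fin (2*k)) (Fin (2*k)) (MvPolynomial σ ℂ)) : Set (MvPolynomial σ ℂ) :=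
  { q | ∃ e : Fin (2*(k-1)) ↪o Fin (2*k), q = pfaff (M.submatrix e e) }

/-- The set of submaximal Pfaffians of a skew-symmetric matrix of odd size `2k-1`:
Pfaffians of the submatrices obtained by erasing one row and the column
with the same index. -/
def submaxPfOdd {σ : Type*} {k : ℕ}
    (M : Matrix (Fin (2*k-1)) (Fin (2*k-1)) (MvPolynomial σ ℂ)) : Set (MvPolynomial σ ℂ) :=
  { q | ∃ e : Fin (2*(k-1)) ↪o Fin (2*k-1), q = pfaff (M.submatrix e e) }

section Algebra

/-- Generic lifting of points along a dominant polynomial map. -/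
theorem AlgebraicIndependent.exists_ne_zero_forall_exists_eval_eq {K T ι : Type*} [Field K]
    [IsAlgClosed K] [Finite T] [Finite ι] {φ : T → MvPolynomial ι K}
    (h : AlgebraicIndependent K φ) :
    ∃ p : MvPolynomial T K, p ≠ 0 ∧
      ∀ y : T → K, eval y p ≠ 0 → ∃ v : ι → K, ∀ t, eval v (φ t) = y t := by
  set f : MvPolynomial T K →+* MvPolynomial ι K := (aeval φ : _ →ₐ[K] _).toRingHom with hf
  have hinj : Function.Injective f := h
  have hfin : f.FinitePresentation := by
    rw [← RingHom.FinitePresentation.of_finiteType]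
    refine RingHom.FiniteType.of_comp_finiteType (f := (C : K →+* MvPolynomial T K)) ?_
    have : f.comp C = algebraMap K (MvPolynomial ι K) := by
      ext x; simp [hf]
    rw [this, RingHom.finiteType_algebraMap]
    infer_instance
  obtain ⟨S, hS⟩ := PrimeSpectrum.exists_constructibleSetData_iff.mpr
    (PrimeSpectrum.isConstructible_range_comap hfin)
  have hbot : (⊥ : PrimeSpectrum (MvPolynomial T K)) ∈ S.toSet := by
    rw [hS]
    refine ⟨⊥, ?_⟩
    ext x
    simp [PrimeSpectrum.comap_asIdeal, map_eq_zero_iff f hinj]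
  simp only [PrimeSpectrum.ConstructibleSetData.toSet, Set.mem_iUnion] at hbot
  obtain ⟨c, hcS, hc⟩ := hbot
  have hg : ∀ i, c.g i = 0 := by
    intro i
    have := hc.1 ⟨i, rfl⟩
    simpa using this
  refine ⟨c.f, fun h0 => hc.2 (by simp [h0]), fun y hy => ?_⟩
  set m : Ideal (MvPolynomial T K) := RingHom.ker (eval y) with hm
  have hmax : m.IsMaximal := RingHom.ker_isMaximal_of_surjective _
    (fun a => ⟨C a, by simp⟩)
  have hmem : (⟨m, hmax.isPrime⟩ : PrimeSpectrum (MvPolynomial T K)) ∈ S.toSet := by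
    simp only [PrimeSpectrum.ConstructibleSetData.toSet, Set.mem_iUnion]
    refine ⟨c, hcS, ?_, ?_⟩
    · rintro _ ⟨i, rfl⟩
      simp [hg]
    · simpa [PrimeSpectrum.mem_zeroLocus, hm] using hy
  rw [hS] at hmem
  obtain ⟨q, hq⟩ := hmem
  obtain ⟨M, hM, hqM⟩ := q.asIdeal.exists_le_maximal q.2.ne_top
  obtain ⟨v, hv⟩ := eq_vanishingIdeal_singleton_of_isMaximal K hM
  refine ⟨v, fun t => ?_⟩
  have h1 : (X t - C (y t) : MvPolynomial T K) ∈ m := by simp [hm]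
  have h2 : m = q.asIdeal.comap f := by
    rw [← PrimeSpectrum.comap_asIdeal, hq]
  rw [h2] at h1
  have h3 := hqM h1
  rw [hv, mem_vanishingIdeal_singleton_iff] at h3
  simpa [hf, sub_eq_zero, aeval_eq_eval] using h3

theorem MvPolynomial.eq_C_of_pderiv_eq_zero {K T : Type*} [Field K] [CharZero K]
    {G : MvPolynomial T K} (h : ∀ t, pderiv t G = 0) : G = C (coeff 0 G) := by
  classical
  ext n
  rw [coeff_C]
  split_ifs with h0
  · rw [h0]
  · obtain ⟨t, ht⟩ : ∃ t, n t ≠ 0 := by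
      by_contra! hn
      exact h0 (by ext t; simp [hn])
    have hle : Finsupp.single t 1 ≤ n := by
      simpa [Finsupp.single_le_iff] using Nat.one_le_iff_ne_zero.mpr ht
    have := coeff_pderiv (i := t) G (n - Finsupp.single t 1)
    rw [h t, tsub_add_cancel_of_le hle, coeff_zero] at this
    exact (mul_eq_zero.mp this.symm).resolve_right (by norm_cast)

theorem MvPolynomial.totalDegree_pderiv_lt {K T : Type*} [Field K]
    {G : MvPolynomial T K} {t : T} (h : pderiv t G ≠ 0) :
    (pderiv t G).totalDegree < G.totalDegree := by
  classical
  have key : ∀ m ∈ (pderiv t G).support, m.degree < G.totalDegree := by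
    intro m hm
    rw [mem_support_iff, coeff_pderiv] at hm
    have := le_totalDegree (mem_support_iff.mpr (left_ne_zero_of_mul hm))
    change Finsupp.degree _ ≤ _ at this
    rw [map_add, Finsupp.degree_single] at this
    omega
  obtain ⟨m, hm⟩ := support_nonempty.mpr h
  rw [totalDegree, Finset.sup_lt_iff (by exact (Nat.zero_le _).trans_lt (key m hm))]
  exact key

theorem MvPolynomial.pderiv_aeval {K T ι : Type*} [Field K] [Fintype T]
    (φ : T → MvPolynomial ι K) (G : MvPolynomial T K) (j : ι) :
    pderiv j (aeval φ G) = ∑ t, aeval φ (pderiv t G) * pderiv j (φ t) := by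
  classical
  induction G using MvPolynomial.induction_on with
  | C a => simp
  | add p q hp hq => simp only [map_add, hp, hq, add_mul, Finset.sum_add_distrib]
  | mul_X p t hp =>
    simp only [map_mul, aeval_X, Derivation.leibniz, hp, smul_eq_mul, map_add, add_mul,
      Finset.sum_add_distrib, pderiv_X, Pi.single_apply]
    simp [Finset.mul_sum, mul_assoc, mul_comm]

/-- The Jacobian criterion: polynomials are algebraically independent if their Jacobian has
full rank at some point. -/
theorem algebraicIndependent_of_jacobian {K T ι : Type*} [Field K] [CharZero K]
    [Fintype T] [DecidableEq T] [Fintype ι] (φ : T → MvPolynomial ι K) (v : ι → K)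
    (w : T → ι → K)
    (hw : ∀ t t', ∑ j, w t j * eval v (pderiv j (φ t')) = if t = t' then 1 else 0) :
    AlgebraicIndependent K φ := by
  let M : Matrix T T (MvPolynomial ι K) := .of fun t' t => ∑ j, C (w t j) * pderiv j (φ t')
  have hM : M.det ≠ 0 := by
    intro h0
    have h1 := congrArg (eval v) h0
    rw [RingHom.map_det] at h1
    have : (eval v).mapMatrix M = 1 := by
      ext t' t
      simp [M, hw, Matrix.one_apply, eq_comm]
    simp [this] at h1
  rw [algebraicIndependent_iff]
  intro G
  induction hN : G.totalDegree using Nat.strong_induction_on generalizing G with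
  | _ N ih =>
  intro hG
  have hz : (fun t => aeval φ (pderiv t G)) = 0 := by
    refine Matrix.eq_zero_of_vecMul_eq_zero hM ?_
    ext1 t
    simp only [Matrix.vecMul, dotProduct, M, Matrix.of_apply, Finset.mul_sum, Pi.zero_apply]
    rw [Finset.sum_comm]
    refine Finset.sum_eq_zero fun j _ => ?_
    have := pderiv_aeval φ G j
    rw [hG, map_zero] at this
    simp only [mul_left_comm _ (C _), ← Finset.mul_sum, ← this, mul_zero]
  have hp : ∀ t, pderiv t G = 0 := by
    intro t
    by_contra hne
    exact hne (ih _ (hN ▸ totalDegree_pderiv_lt hne) _ rfl (congrFun hz t))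
  have hC := eq_C_of_pderiv_eq_zero hp
  rw [hC] at hG ⊢
  simpa using hG

theorem Derivation.eq_zero_of_isTranscendenceBasis {K S L b : Type*} [Field K] [CharZero K]
    [CommRing S] [Algebra K S] [Field L] [Algebra K L] [Algebra S L]
    [IsScalarTower K S L] [FaithfulSMul S L] {x : b → S} (hx : IsTranscendenceBasis K x)
    (D : Derivation K S L) (hD : ∀ i, D (x i) = 0) : D = 0 := by
  have : IsDomain S := (FaithfulSMul.algebraMap_injective S L).isDomain
  set P := Algebra.adjoin K (Set.range x) with hP
  have hDP : ∀ p ∈ P, D p = 0 := by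
    have : Set.EqOn D (0 : Derivation K S L) (Set.range x) := by
      rintro _ ⟨i, rfl⟩
      simp [hD]
    exact fun p hp => Derivation.eqOn_adjoin this hp
  let D' : Derivation P S L :=
    { toFun := D
      map_add' := by simp
      map_smul' := fun p s => by
        change D ((p : S) * s) = (p : S) • D s
        simp [hDP p p.2]
      map_one_eq_zero' := by simp
      leibniz' := by simp }
  have halg : Algebra.IsAlgebraic P S := hx.isAlgebraic
  have : CharZero P := charZero_of_injective_algebraMap (algebraMap K P).injective
  ext s
  let A : Set (Polynomial P) := {g | g ≠ 0 ∧ Polynomial.aeval s g = 0}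
  have hA : A.Nonempty := halg.isAlgebraic s
  obtain ⟨g, ⟨hg0, hgs⟩, hgmin⟩ :=
    (measure (Polynomial.natDegree (R := P))).wf.has_min A hA
  have hder : Polynomial.derivative g ≠ 0 := by
    intro h0
    obtain ⟨c, rfl⟩ := Polynomial.natDegree_eq_zero.mp
      (Polynomial.derivative_eq_zero.mp h0)
    rw [Polynomial.aeval_C] at hgs
    exact hg0 (by rw [Subtype.ext (a1 := c) (a2 := 0) hgs, map_zero])
  have hs : Polynomial.aeval s (Polynomial.derivative g) ≠ 0 := fun h0 =>
    hgmin _ ⟨hder, h0⟩ (Polynomial.natDegree_derivative_lt fun hd => hder <| by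
      rw [Polynomial.eq_C_of_natDegree_eq_zero hd, Polynomial.derivative_C])
  have h1 := D'.map_aeval g s
  rw [hgs, map_zero] at h1
  exact (smul_eq_zero.mp h1.symm).resolve_left hs

theorem MvPolynomial.mkDerivation_eq_sum {K ι L : Type*} [CommRing K] [Fintype ι] [CommRing L]
    [Algebra K L] [Algebra (MvPolynomial ι K) L] [IsScalarTower K (MvPolynomial ι K) L]
    (c : ι → L) (f : MvPolynomial ι K) :
    mkDerivation K c f = ∑ j, algebraMap _ L (pderiv j f) * c j := by
  classical
  induction f using MvPolynomial.induction_on with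
  | C a => simp
  | add p q hp hq => simp only [map_add, hp, hq, add_mul, Finset.sum_add_distrib]
  | mul_X p i hp =>
    rw [Derivation.leibniz, hp]
    simp only [mkDerivation_X, Derivation.leibniz, pderiv_X, smul_eq_mul, map_add, map_mul,
      add_mul, Finset.sum_add_distrib, Algebra.smul_def, Finset.mul_sum, Pi.single_apply]
    simp [mul_assoc]

/-- In characteristic zero, the Jacobian of algebraically independent polynomials has a right
inverse after inverting a nonzero polynomial. -/
theorem AlgebraicIndependent.exists_jacobian_right_inverse {K T ι : Type*} [Field K] [CharZero K]
    [Finite T] [DecidableEq T] [Fintype ι] {φ : T → MvPolynomial ι K}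
    (h : AlgebraicIndependent K φ) :
    ∃ (q : MvPolynomial ι K) (B : T → ι → MvPolynomial ι K), q ≠ 0 ∧
      ∀ t t', ∑ j, B t j * pderiv j (φ t') = if t = t' then q else 0 := by
  classical
  let L := FractionRing (MvPolynomial ι K)
  obtain ⟨b, hTb, hb⟩ := exists_isTranscendenceBasis_superset h.coe_range
  have hcard := hb.lift_cardinalMk_eq (IsTranscendenceBasis.mvPolynomial ι K)
  have : Finite b := by
    rw [← Cardinal.lt_aleph0_iff_finite]
    rw [← Cardinal.lift_lt_aleph0, hcard, Cardinal.lift_lt_aleph0]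
    exact Cardinal.lt_aleph0_of_finite ι
  have : Fintype b := Fintype.ofFinite b
  have hcard' : Fintype.card ι = Fintype.card b := by
    simpa using hcard.symm
  let D (c : ι → L) : Derivation K (MvPolynomial ι K) L := mkDerivation K c
  have hDc (c : ι → L) (f : MvPolynomial ι K) :
      D c f = ∑ j, algebraMap _ L (pderiv j f) * c j :=
    mkDerivation_eq_sum c f
  let F : (ι → L) →ₗ[L] (b → L) :=
    { toFun := fun c i => D c i
      map_add' := fun c c' => by
        ext i; simp [hDc, mul_add, Finset.sum_add_distrib]
      map_smul' := fun r c => by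
        ext i
        simp only [Pi.smul_apply, smul_eq_mul, hDc, mul_left_comm _ r, ← Finset.mul_sum,
          RingHom.id_apply] }
  have hinj : Function.Injective F := by
    rw [injective_iff_map_eq_zero]
    intro c hc
    have := (D c).eq_zero_of_isTranscendenceBasis hb (fun i => congrFun hc i)
    ext j
    have h2 := congrArg (fun E : Derivation K (MvPolynomial ι K) L => E (X j)) this
    simpa [D] using h2
  have hsurj : Function.Surjective F :=
    (LinearMap.injective_iff_surjective_of_finrank_eq_finrank (by simp [hcard'])).mp hinj
  choose c hc using fun t : T => hsurj (Pi.single ⟨φ t, hTb ⟨t, rfl⟩⟩ 1)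
  obtain ⟨q, hq⟩ := IsLocalization.exist_integer_multiples_of_finite
    (nonZeroDivisors (MvPolynomial ι K)) (fun x : T × ι => c x.1 x.2)
  choose B hB using hq
  refine ⟨q, fun t j => B (t, j), nonZeroDivisors.ne_zero q.2, fun t t' => ?_⟩
  apply IsFractionRing.injective (MvPolynomial ι K) L
  have h1 := congrFun (hc t) ⟨φ t', hTb ⟨t', rfl⟩⟩
  change D (c t) (φ t') = _ at h1
  rw [hDc, Pi.single_apply] at h1
  simp only [map_sum, map_mul, hB, Algebra.smul_mul_assoc, mul_comm (c t _), ← Finset.smul_sum, h1]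
  have hiff : φ t' = φ t ↔ t = t' := by rw [h.injective.eq_iff, eq_comm]
  simp only [Subtype.mk.injEq, hiff]
  split_ifs <;> simp [Algebra.smul_def]

end Algebra

section Pfaffian

variable {B B' : Type*} [CommRing B] [Algebra ℂ B] [CommRing B'] [Algebra ℂ B'] {n : ℕ}

/-- The first index of the `i`-th pair in `Fin (2 * n)`. -/
def pairFst (i : Fin n) : Fin (2*n) := ⟨2*i.1, by have := i.2; omega⟩

/-- The second index of the `i`-th pair in `Fin (2 * n)`. -/
def pairSnd (i : Fin n) : Fin (2*n) := ⟨2*i.1+1, by have := i.2; omega⟩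

/-- The Pfaffian of a matrix over a commutative `ℂ`-algebra. -/
noncomputable def genPfaff (M : Matrix (Fin (2*n)) (Fin (2*n)) B) : B :=
  (((2^n * n.factorial : ℕ) : ℂ)⁻¹) •
    ∑ p : Equiv.Perm (Fin (2*n)),
      (Equiv.Perm.sign p : ℤ) • ∏ i : Fin n, M (p (pairFst i)) (p (pairSnd i))

/-- The formal partial derivative of the Pfaffian with respect to the entry `(a, b)`. -/
noncomputable def pfaffCof (M : Matrix (Fin (2*n)) (Fin (2*n)) B) (a b : Fin (2*n)) : B :=
  (((2^n * n.factorial : ℕ) : ℂ)⁻¹) •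
    ∑ p : Equiv.Perm (Fin (2*n)), ∑ i : Fin n,
      if p (pairFst i) = a ∧ p (pairSnd i) = b then
        (Equiv.Perm.sign p : ℤ) • ∏ l ∈ Finset.univ.erase i, M (p (pairFst l)) (p (pairSnd l))
      else 0

theorem pfaff_eq_genPfaff {σ : Type*} (M : Matrix (Fin (2*n)) (Fin (2*n)) (MvPolynomial σ ℂ)) :
    pfaff M = genPfaff M := rfl

theorem map_genPfaff (f : B →ₐ[ℂ] B') (M : Matrix (Fin (2*n)) (Fin (2*n)) B) :
    f (genPfaff M) = genPfaff (M.map f) := by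
  simp [genPfaff, map_sum, map_prod]

theorem map_pfaffCof (f : B →ₐ[ℂ] B') (M : Matrix (Fin (2*n)) (Fin (2*n)) B) (a b : Fin (2*n)) :
    f (pfaffCof M a b) = pfaffCof (M.map f) a b := by
  simp [pfaffCof, map_sum, map_prod, apply_ite f]

theorem Derivation.leibniz_finset_prod {R A ι : Type*} [CommRing R] [CommRing A] [Algebra R A]
    [DecidableEq ι] (D : Derivation R A A) (s : Finset ι) (f : ι → A) :
    D (∏ i ∈ s, f i) = ∑ i ∈ s, D (f i) * ∏ l ∈ s.erase i, f l := by
  induction s using Finset.induction_on with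
  | empty => simp
  | insert a s ha ih =>
    rw [Finset.prod_insert ha, Derivation.leibniz, ih, Finset.sum_insert ha,
      Finset.erase_insert ha, add_comm]
    simp only [smul_eq_mul, Finset.mul_sum]
    congr 1
    · ring
    · refine Finset.sum_congr rfl fun i hi => ?_
      have hia : a ≠ i := fun h => ha (h ▸ hi)
      rw [Finset.erase_insert_of_ne hia, Finset.prod_insert fun h =>
        ha (Finset.mem_of_mem_erase h)]
      ring

theorem derivation_genPfaff {R : Type*} [CommRing R] [Algebra R B] [Algebra ℂ R]
    [IsScalarTower ℂ R B] (D : Derivation R B B) (M : Matrix (Fin (2*n)) (Fin (2*n)) B) :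
    D (genPfaff M) = ∑ a, ∑ b, D (M a b) * pfaffCof M a b := by
  have hsmul (c : ℂ) (x : B) : D (c • x) = c • D x := by
    rw [← algebraMap_smul R c x, D.map_smul, algebraMap_smul]
  simp only [genPfaff, pfaffCof, hsmul, mul_smul_comm, ← Finset.smul_sum]
  congr 1
  simp only [map_sum, Finset.mul_sum]
  have : ∀ (p : Equiv.Perm (Fin (2*n))),
      D ((Equiv.Perm.sign p : ℤ) • ∏ i : Fin n, M (p (pairFst i)) (p (pairSnd i))) =
      ∑ i, ∑ a, ∑ b, D (M a b) * if p (pairFst i) = a ∧ p (pairSnd i) = b then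
        (Equiv.Perm.sign p : ℤ) • ∏ l ∈ Finset.univ.erase i, M (p (pairFst l)) (p (pairSnd l))
        else 0 := by
    intro p
    rw [map_zsmul, Derivation.leibniz_finset_prod, Finset.smul_sum]
    refine Finset.sum_congr rfl fun i _ => ?_
    simp [ite_and, mul_ite, mul_left_comm]
  simp only [this]
  symm
  refine (Finset.sum_congr rfl fun a _ => Finset.sum_comm).trans
    (Finset.sum_comm.trans (Finset.sum_congr rfl fun p _ => ?_))
  exact (Finset.sum_congr rfl fun a _ => Finset.sum_comm).trans Finset.sum_comm

/-- The permutation of `Fin (2 * (n + 1))` exchanging the `i`-th pair with the last one. -/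
def pairSwap (i : Fin (n+1)) : Equiv.Perm (Fin (2*(n+1))) :=
  Equiv.swap (pairFst i) (pairFst (Fin.last n)) * Equiv.swap (pairSnd i) (pairSnd (Fin.last n))

theorem pairFst_inj {i j : Fin n} : pairFst i = pairFst j ↔ i = j := by
  simp [pairFst, Fin.ext_iff]

theorem pairSnd_inj {i j : Fin n} : pairSnd i = pairSnd j ↔ i = j := by
  simp [pairSnd, Fin.ext_iff]

theorem pairFst_ne_pairSnd (i j : Fin n) : pairFst i ≠ pairSnd j := by
  simp only [pairFst, pairSnd, ne_eq, Fin.mk.injEq]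
  omega

theorem sign_pairSwap (i : Fin (n+1)) : Equiv.Perm.sign (pairSwap i) = 1 := by
  simp only [pairSwap, Equiv.Perm.sign_mul, Equiv.Perm.sign_swap', pairFst_inj, pairSnd_inj]
  split_ifs <;> simp

theorem pairSwap_pairFst (i l : Fin (n+1)) :
    pairSwap i (pairFst l) = pairFst (Equiv.swap i (Fin.last n) l) := by
  simp only [pairSwap, Equiv.Perm.mul_apply, Equiv.swap_apply_def, pairFst_ne_pairSnd, if_false,
    pairFst_inj]
  split_ifs <;> rfl

theorem pairSwap_pairSnd (i l : Fin (n+1)) :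
    pairSwap i (pairSnd l) = pairSnd (Equiv.swap i (Fin.last n) l) := by
  simp only [pairSwap, Equiv.Perm.mul_apply, Equiv.swap_apply_def, pairSnd_inj]
  split_ifs <;> simp_all [(pairFst_ne_pairSnd _ _).symm]

/-- The inclusion of `Fin (2 * n)` in `Fin (2 * (n + 1))` missing the last pair. -/
def initPairs (j : Fin (2*n)) : Fin (2*(n+1)) := ⟨j.1, by have := j.2; omega⟩

theorem sum_pair_eq_sum_last_pair {R : Type*} [CommRing R]
    (M : Matrix (Fin (2*(n+1))) (Fin (2*(n+1))) R) (a b : Fin (2*(n+1))) (i : Fin (n+1)) :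
    (∑ p : Equiv.Perm (Fin (2*(n+1))), if p (pairFst i) = a ∧ p (pairSnd i) = b then
        (Equiv.Perm.sign p : ℤ) • ∏ l ∈ Finset.univ.erase i, M (p (pairFst l)) (p (pairSnd l))
      else 0) =
    ∑ p : Equiv.Perm (Fin (2*(n+1))),
      if p (pairFst (Fin.last n)) = a ∧ p (pairSnd (Fin.last n)) = b then
        (Equiv.Perm.sign p : ℤ) • ∏ l : Fin n, M (p (pairFst l.castSucc)) (p (pairSnd l.castSucc))
      else 0 := by
  refine Fintype.sum_equiv (Equiv.mulRight (pairSwap i)) _ _ fun p => ?_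
  simp only [Equiv.coe_mulRight, Equiv.Perm.mul_apply, pairSwap_pairFst, pairSwap_pairSnd,
    Equiv.swap_apply_right, Equiv.Perm.sign_mul, sign_pairSwap, mul_one]
  congr 2
  refine Finset.prod_bij' (fun l hl => (Equiv.swap i (Fin.last n) l).castPred ?_)
    (fun l _ => Equiv.swap i (Fin.last n) l.castSucc) ?_ ?_ ?_ ?_ ?_
  · have := Finset.ne_of_mem_erase hl
    rwa [ne_eq, Equiv.swap_apply_eq_iff, Equiv.swap_apply_right]
  · simp
  · intro l _
    simp only [Finset.mem_erase, Finset.mem_univ, and_true, ne_eq]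
    rw [Equiv.swap_apply_eq_iff, Equiv.swap_apply_left]
    exact Fin.castSucc_ne_last l
  · simp
  · simp
  · simp

theorem pfaffCof_apply (M : Matrix (Fin (2*(n+1))) (Fin (2*(n+1))) B)
    (τ : Equiv.Perm (Fin (2*(n+1)))) :
    pfaffCof M (τ (pairFst (Fin.last n))) (τ (pairSnd (Fin.last n))) =
      (((Equiv.Perm.sign τ : ℤ) : ℂ) / 2) •
        genPfaff (M.submatrix (τ ∘ initPairs) (τ ∘ initPairs)) := by
  simp only [pfaffCof, genPfaff]
  rw [Finset.sum_comm]
  simp only [sum_pair_eq_sum_last_pair, Finset.sum_const, Finset.card_univ, Fintype.card_fin]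
  have key : (∑ p : Equiv.Perm (Fin (2*(n+1))),
      if p (pairFst (Fin.last n)) = τ (pairFst (Fin.last n)) ∧
          p (pairSnd (Fin.last n)) = τ (pairSnd (Fin.last n)) then
        (Equiv.Perm.sign p : ℤ) • ∏ l : Fin n, M (p (pairFst l.castSucc)) (p (pairSnd l.castSucc))
      else 0) = (Equiv.Perm.sign τ : ℤ) • ∑ q : Equiv.Perm (Fin (2*n)),
        (Equiv.Perm.sign q : ℤ) • ∏ i : Fin n, (M.submatrix (τ ∘ initPairs) (τ ∘ initPairs))
          (q (pairFst i)) (q (pairSnd i)) := by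
    rw [← Finset.sum_filter, Finset.smul_sum]
    symm
    let e : Fin (2*n) ≃ {j : Fin (2*(n+1)) // j.1 < 2*n} :=
      { toFun := fun j => ⟨initPairs j, j.2⟩
        invFun := fun j => ⟨j.1.1, j.2⟩
        left_inv := fun j => rfl
        right_inv := fun j => rfl }
    have hlast {j : Fin (2*(n+1))} (hj : ¬ j.1 < 2*n) :
        j = pairFst (Fin.last n) ∨ j = pairSnd (Fin.last n) := by
      simp only [pairFst, pairSnd, Fin.ext_iff, Fin.val_last]
      have := j.2
      omega
    have hext (q : Equiv.Perm (Fin (2*n))) (j : Fin (2*n)) :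
        q.extendDomain e (initPairs j) = initPairs (q j) :=
      Equiv.Perm.extendDomain_apply_image q e j
    have hfst (q : Equiv.Perm (Fin (2*n))) :
        q.extendDomain e (pairFst (Fin.last n)) = pairFst (Fin.last n) :=
      Equiv.Perm.extendDomain_apply_not_subtype _ _ (by simp [pairFst])
    have hsnd (q : Equiv.Perm (Fin (2*n))) :
        q.extendDomain e (pairSnd (Fin.last n)) = pairSnd (Fin.last n) :=
      Equiv.Perm.extendDomain_apply_not_subtype _ _ (by simp [pairSnd])
    refine Finset.sum_bij (fun q _ => τ * q.extendDomain e) ?_ ?_ ?_ ?_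
    · intro q _
      simp [hfst, hsnd]
    · intro q _ q' _ h
      exact Equiv.Perm.extendDomainHom_injective e (mul_left_cancel h)
    · intro p hp
      rw [Finset.mem_filter] at hp
      obtain ⟨-, h1, h2⟩ := hp
      have hfix (j : Fin (2*(n+1))) (hj : ¬ j.1 < 2*n) : (τ⁻¹ * p) j = j := by
        rcases hlast hj with rfl | rfl
        · simp [h1]
        · simp [h2]
      have hiff (j : Fin (2*(n+1))) : ((τ⁻¹ * p) j).1 < 2*n ↔ j.1 < 2*n := by
        constructor
        · intro h
          by_contra hj
          rw [hfix j hj] at h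
          exact hj h
        · intro h
          by_contra hj
          have := (τ⁻¹ * p).injective (hfix _ hj)
          rw [this] at hj
          exact hj h
      refine ⟨e.symm.permCongr ((τ⁻¹ * p).subtypePerm hiff), Finset.mem_univ _, ?_⟩
      ext1 j
      rw [Equiv.Perm.mul_apply, eq_comm, ← Equiv.Perm.inv_eq_iff_eq, ← Equiv.Perm.mul_apply]
      by_cases hj : j.1 < 2*n
      · obtain ⟨j, rfl⟩ : ∃ j', j = initPairs j' := ⟨⟨j, hj⟩, rfl⟩
        rw [hext]
        rfl
      · rw [hfix j hj]
        rcases hlast hj with rfl | rfl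
        · rw [hfst]
        · rw [hsnd]
    · intro q _
      have hf (l : Fin n) : pairFst l.castSucc = initPairs (pairFst l) := rfl
      have hs (l : Fin n) : pairSnd l.castSucc = initPairs (pairSnd l) := rfl
      simp only [Equiv.Perm.mul_apply, hf, hs, hext, Equiv.Perm.sign_mul,
        Equiv.Perm.sign_extendDomain, Matrix.submatrix_apply, Function.comp_apply, smul_smul,
        Units.val_mul]
  rw [key, ← Nat.cast_smul_eq_nsmul ℂ, ← Int.cast_smul_eq_zsmul ℂ, smul_smul, smul_smul, smul_smul]
  congr 1
  have h1 : ((n : ℂ) + 1) ≠ 0 := by exact_mod_cast n.succ_ne_zero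
  have h2 : (n.factorial : ℂ) ≠ 0 := by exact_mod_cast n.factorial_ne_zero
  rw [Nat.factorial_succ]
  push_cast
  field_simp
  ring

end Pfaffian

section Cofactors

variable {B : Type*} [CommRing B] [Algebra ℂ B] {n : ℕ}

theorem sum_eq_sum_pairs {R : Type*} [AddCommMonoid R] (f : Fin (2*n) → R) :
    ∑ j, f j = ∑ i, (f (pairFst i) + f (pairSnd i)) := by
  rw [← Equiv.sum_comp (finProdFinEquiv.trans (finCongr (mul_comm n 2))), Fintype.sum_prod_type]
  refine Finset.sum_congr rfl fun i _ => ?_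
  rw [Fin.sum_univ_two]
  congr 2 <;> simp [pairFst, pairSnd, Fin.ext_iff, add_comm]

theorem sum_eq_sum_initPairs_add {R : Type*} [AddCommMonoid R] (f : Fin (2*(n+1)) → R) :
    ∑ j, f j = ∑ j, f (initPairs j) +
      (f (pairFst (Fin.last n)) + f (pairSnd (Fin.last n))) := by
  rw [sum_eq_sum_pairs, Fin.sum_univ_castSucc, sum_eq_sum_pairs (fun j => f (initPairs j))]
  rfl

theorem exists_perm_initPairs (e : Fin (2*n) ↪ Fin (2*(n+1))) {a b : Fin (2*(n+1))}
    (hab : a ≠ b) (ha : ∀ j, e j ≠ a) (hb : ∀ j, e j ≠ b) :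
    ∃ τ : Equiv.Perm (Fin (2*(n+1))), (∀ j, τ (initPairs j) = e j) ∧
      τ (pairFst (Fin.last n)) = a ∧ τ (pairSnd (Fin.last n)) = b := by
  let f : Fin (2*(n+1)) → Fin (2*(n+1)) := fun j =>
    if h : j.1 < 2*n then e ⟨j.1, h⟩ else if j.1 = 2*n then a else b
  have hf : Function.Injective f := by
    intro i j hij
    have hi := i.2
    have hj := j.2
    simp only [f] at hij
    split_ifs at hij with h1 h2 h3 h4 h5 h6 h7
    · simpa [Fin.ext_iff] using hij
    · exact (ha _ hij).elim
    · exact (hb _ hij).elim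
    · exact (ha _ hij.symm).elim
    · exact Fin.ext (by omega)
    · exact (hab hij).elim
    · exact (hb _ hij.symm).elim
    · exact (hab hij.symm).elim
    · exact Fin.ext (by omega)
  refine ⟨Equiv.ofBijective f (Finite.injective_iff_bijective.1 hf), fun j => ?_, ?_, ?_⟩
  · simp [f, initPairs]
  · simp [f, pairFst]
  · simp [f, pairSnd]

theorem exists_pfaffCof_eq_smul (e : Fin (2*n) ↪o Fin (2*(n+1))) {a b : Fin (2*(n+1))}
    (hab : a ≠ b) (ha : ∀ j, e j ≠ a) (hb : ∀ j, e j ≠ b) :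
    ∃ u : ℂ, u ≠ 0 ∧ ∀ M : Matrix (Fin (2*(n+1))) (Fin (2*(n+1))) B,
      pfaffCof M a b = u • genPfaff (M.submatrix e e) ∧
      pfaffCof M b a = -u • genPfaff (M.submatrix e e) := by
  obtain ⟨τ, he, rfl, rfl⟩ := exists_perm_initPairs e.toEmbedding hab ha hb
  have he1 : τ ∘ initPairs = e := funext he
  refine ⟨((Equiv.Perm.sign τ : ℤ) : ℂ) / 2, ?_, fun M => ⟨?_, ?_⟩⟩
  · simp
  · rw [pfaffCof_apply, he1]
  · let τ' := τ * Equiv.swap (pairFst (Fin.last n)) (pairSnd (Fin.last n))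
    have he2 : τ' ∘ initPairs = e := by
      rw [← he1]
      funext j
      have hj := j.2
      simp only [τ', Function.comp_apply, Equiv.Perm.mul_apply]
      rw [Equiv.swap_apply_of_ne_of_ne]
      · simp only [initPairs, pairFst, ne_eq, Fin.mk.injEq, Fin.val_last]
        omega
      · simp only [initPairs, pairSnd, ne_eq, Fin.mk.injEq, Fin.val_last]
        omega
    have := pfaffCof_apply M τ'
    rw [he2] at this
    simpa [τ', Equiv.Perm.sign_swap (pairFst_ne_pairSnd _ _), neg_div] using this

theorem exists_orderEmbedding_ne_ne {a b : Fin (2*(n+1))} (hab : a ≠ b) :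
    ∃ e : Fin (2*n) ↪o Fin (2*(n+1)), (∀ j, e j ≠ a) ∧ ∀ j, e j ≠ b := by
  have hcard : (({a, b} : Finset (Fin (2*(n+1))))ᶜ).card = 2*n := by
    rw [Finset.card_compl, Finset.card_pair hab, Fintype.card_fin]
    omega
  refine ⟨Finset.orderEmbOfFin _ hcard, fun j h => ?_, fun j h => ?_⟩ <;>
  · have := Finset.orderEmbOfFin_mem _ hcard j
    rw [h] at this
    simp at this

theorem exists_ne_ne_of_orderEmbedding (e : Fin (2*n) ↪o Fin (2*(n+1))) :
    ∃ a b, a ≠ b ∧ (∀ j, e j ≠ a) ∧ ∀ j, e j ≠ b := by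
  have hcard : ((Finset.univ.map e.toEmbedding)ᶜ).card = 2 := by
    rw [Finset.card_compl, Finset.card_map, Fintype.card_fin, Finset.card_univ, Fintype.card_fin]
    omega
  obtain ⟨a, b, hab, h⟩ := Finset.card_eq_two.1 hcard
  refine ⟨a, b, hab, fun j hj => ?_, fun j hj => ?_⟩
  · have : a ∈ (Finset.univ.map e.toEmbedding)ᶜ := by simp [h]
    rw [Finset.mem_compl] at this
    exact this (Finset.mem_map.2 ⟨j, Finset.mem_univ j, hj⟩)
  · have : b ∈ (Finset.univ.map e.toEmbedding)ᶜ := by simp [h]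
    rw [Finset.mem_compl] at this
    exact this (Finset.mem_map.2 ⟨j, Finset.mem_univ j, hj⟩)

theorem pfaffCof_self (M : Matrix (Fin (2*n)) (Fin (2*n)) B) (a : Fin (2*n)) :
    pfaffCof M a a = 0 := by
  have h (p : Equiv.Perm (Fin (2*n))) (i : Fin n) :
      ¬ (p (pairFst i) = a ∧ p (pairSnd i) = a) := fun ⟨h1, h2⟩ =>
    pairFst_ne_pairSnd i i (p.injective (h1.trans h2.symm))
  simp [pfaffCof, h]

end Cofactors

section Degrees

variable {σ : Type*} {n d : ℕ}

theorem HomogMat.two_mul_eq {m : Type*} {A : Matrix m m ℕ} (hhom : HomogMat A) (hsym : A.IsSymm)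
    (a b : m) : 2 * A a b = A a a + A b b := by
  have h1 := hhom a a b b
  have h2 := hsym.apply a b
  omega

theorem isHomogeneous_pfaff {A : Matrix (Fin (2*n)) (Fin (2*n)) ℕ} (hsym : A.IsSymm)
    (hhom : HomogMat A) (htr : A.trace = 2 * d)
    {M : Matrix (Fin (2*n)) (Fin (2*n)) (MvPolynomial σ ℂ)} (hM : DegMat M A) :
    (pfaff M).IsHomogeneous d := by
  rw [pfaff_eq_genPfaff, genPfaff, MvPolynomial.smul_eq_C_mul]
  refine IsHomogeneous.C_mul ?_ _
  refine IsHomogeneous.sum _ _ _ fun p _ => ?_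
  have h := IsHomogeneous.prod Finset.univ (fun i : Fin n => M (p (pairFst i)) (p (pairSnd i)))
    (fun i => A (p (pairFst i)) (p (pairSnd i))) fun i _ => hM _ _
  have hd : ∑ i : Fin n, A (p (pairFst i)) (p (pairSnd i)) = d := by
    have h2 : 2 * ∑ i : Fin n, A (p (pairFst i)) (p (pairSnd i)) = A.trace := by
      simp only [Finset.mul_sum, hhom.two_mul_eq hsym, Matrix.trace, Matrix.diag]
      rw [← sum_eq_sum_pairs (fun j => A (p j) (p j)), Equiv.sum_comp p fun j => A j j]
    omega
  rw [hd] at h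
  rw [← Int.cast_smul_eq_zsmul ℂ, MvPolynomial.smul_eq_C_mul]
  exact IsHomogeneous.C_mul h _

theorem exists_isHomogeneous_pfaff_submatrix {A : Matrix (Fin (2*(n+1))) (Fin (2*(n+1))) ℕ}
    (hsym : A.IsSymm) (hhom : HomogMat A) (htr : A.trace = 2 * d)
    {M : Matrix (Fin (2*(n+1))) (Fin (2*(n+1))) (MvPolynomial σ ℂ)} (hM : DegMat M A)
    (e : Fin (2*n) ↪o Fin (2*(n+1))) {a b : Fin (2*(n+1))}
    (hab : a ≠ b) (ha : ∀ j, e j ≠ a) (hb : ∀ j, e j ≠ b) :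
    ∃ d', A a b + d' = d ∧ (pfaff (M.submatrix e e)).IsHomogeneous d' := by
  have key : A.trace = (A.submatrix e e).trace + 2 * A a b := by
    obtain ⟨τ, he, rfl, rfl⟩ := exists_perm_initPairs e.toEmbedding hab ha hb
    rw [hhom.two_mul_eq hsym, Matrix.trace, ← Equiv.sum_comp τ, sum_eq_sum_initPairs_add]
    simp only [Matrix.diag, he]
    rfl
  refine ⟨d - A a b, by omega, isHomogeneous_pfaff (A := A.submatrix e e) ?_ ?_ ?_ ?_⟩
  · exact hsym.submatrix _
  · exact fun i j l r => hhom _ _ _ _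
  · omega
  · exact fun i j => hM _ _

theorem homogeneousComponent_mul_of_isHomogeneous (p : MvPolynomial σ ℂ) {q : MvPolynomial σ ℂ}
    {i j : ℕ} (hq : q.IsHomogeneous j) :
    homogeneousComponent (i + j) (p * q) = homogeneousComponent i p * q := by
  conv_lhs => rw [← sum_homogeneousComponent p, Finset.sum_mul, map_sum]
  have h (l : ℕ) : homogeneousComponent (i + j) (homogeneousComponent l p * q) =
      if l = i then homogeneousComponent i p * q else 0 := by
    rw [homogeneousComponent_of_mem ((homogeneousComponent_isHomogeneous l p).mul hq)]
    by_cases hl : l = i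
    · simp [hl]
    · rw [if_neg (by omega), if_neg hl]
  simp only [h, Finset.sum_ite_eq', Finset.mem_range, ite_eq_left_iff, not_lt]
  intro hi
  rw [homogeneousComponent_eq_zero _ _ (by omega), zero_mul]

end Degrees

section Differential

variable {σ ι : Type*} [Fintype ι] {n d : ℕ}

/-- The differential of `∑ i, pfaff (M i)` in the direction `N`. -/
noncomputable def pfaffDiff (M N : ι → Matrix (Fin (2*n)) (Fin (2*n)) (MvPolynomial σ ℂ)) :
    MvPolynomial σ ℂ :=
  ∑ i, ∑ a, ∑ b, N i a b * pfaffCof (M i) a b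

theorem pfaffDiff_add (M N N' : ι → Matrix (Fin (2*n)) (Fin (2*n)) (MvPolynomial σ ℂ)) :
    pfaffDiff M (N + N') = pfaffDiff M N + pfaffDiff M N' := by
  simp [pfaffDiff, add_mul, Finset.sum_add_distrib]

theorem pfaffDiff_smul (c : ℂ) (M N : ι → Matrix (Fin (2*n)) (Fin (2*n)) (MvPolynomial σ ℂ)) :
    pfaffDiff M (c • N) = c • pfaffDiff M N := by
  simp [pfaffDiff, Finset.smul_sum]

theorem pfaffDiff_sum {κ : Type*} (s : Finset κ)
    (M : ι → Matrix (Fin (2*n)) (Fin (2*n)) (MvPolynomial σ ℂ))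
    (N : κ → ι → Matrix (Fin (2*n)) (Fin (2*n)) (MvPolynomial σ ℂ)) :
    pfaffDiff M (∑ x ∈ s, N x) = ∑ x ∈ s, pfaffDiff M (N x) := by
  classical
  induction s using Finset.induction_on with
  | empty => simp [pfaffDiff]
  | insert x s hx ih => rw [Finset.sum_insert hx, Finset.sum_insert hx, pfaffDiff_add, ih]

theorem isHomogeneous_pfaffDiff {A : Matrix (Fin (2*(n+1))) (Fin (2*(n+1))) ℕ}
    (hsym : A.IsSymm) (hhom : HomogMat A) (htr : A.trace = 2 * d)
    {M N : ι → Matrix (Fin (2*(n+1))) (Fin (2*(n+1))) (MvPolynomial σ ℂ)}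
    (hM : ∀ i, DegMat (M i) A) (hN : ∀ i, DegMat (N i) A) :
    (pfaffDiff M N).IsHomogeneous d := by
  refine IsHomogeneous.sum _ _ _ fun i _ => IsHomogeneous.sum _ _ _ fun a _ =>
    IsHomogeneous.sum _ _ _ fun b _ => ?_
  obtain rfl | hab := eq_or_ne a b
  · rw [pfaffCof_self, mul_zero]
    exact isHomogeneous_zero _ _ _
  · obtain ⟨e, ha, hb⟩ := exists_orderEmbedding_ne_ne hab
    obtain ⟨u, -, hu⟩ := exists_pfaffCof_eq_smul (B := MvPolynomial σ ℂ) e hab ha hb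
    obtain ⟨d', rfl, hd'⟩ := exists_isHomogeneous_pfaff_submatrix hsym hhom htr (hM i) e hab ha hb
    rw [(hu (M i)).1, MvPolynomial.smul_eq_C_mul]
    exact (hN i a b).mul (IsHomogeneous.C_mul hd' _)

theorem pfaffDiff_mem_span (M N : ι → Matrix (Fin (2*(n+1))) (Fin (2*(n+1))) (MvPolynomial σ ℂ)) :
    pfaffDiff M N ∈ Ideal.span (⋃ i, submaxPfEven (M i)) := by
  refine Ideal.sum_mem _ fun i _ => Ideal.sum_mem _ fun a _ => Ideal.sum_mem _ fun b _ => ?_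
  obtain rfl | hab := eq_or_ne a b
  · rw [pfaffCof_self, mul_zero]
    exact Ideal.zero_mem _
  · obtain ⟨e, ha, hb⟩ := exists_orderEmbedding_ne_ne hab
    obtain ⟨u, -, hu⟩ := exists_pfaffCof_eq_smul (B := MvPolynomial σ ℂ) e hab ha hb
    rw [(hu (M i)).1, MvPolynomial.smul_eq_C_mul]
    refine Ideal.mul_mem_left _ _ (Ideal.mul_mem_left _ _ (Ideal.subset_span ?_))
    exact Set.mem_iUnion.2 ⟨i, e, rfl⟩

theorem sum_sum_single_mul {m R : Type*} [Fintype m] [DecidableEq m] [CommRing R] (a b : m)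
    (g : R) (f : m → m → R) : ∑ i, ∑ j, Matrix.single a b g i j * f i j = g * f a b := by
  rw [Finset.sum_eq_single a, Finset.sum_eq_single b] <;>
    simp +contextual [Matrix.single_apply, eq_comm]

theorem exists_pfaffDiff_eq_of_mem_span {A : Matrix (Fin (2*(n+1))) (Fin (2*(n+1))) ℕ}
    (hsym : A.IsSymm) (hhom : HomogMat A) (htr : A.trace = 2 * d)
    {M : ι → Matrix (Fin (2*(n+1))) (Fin (2*(n+1))) (MvPolynomial σ ℂ)}
    (hM : ∀ i, DegMat (M i) A) {F : MvPolynomial σ ℂ} (hF : F.IsHomogeneous d)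
    (hFM : F ∈ Ideal.span (⋃ i, submaxPfEven (M i))) :
    ∃ N, (∀ i, IsSkew (N i)) ∧ (∀ i, DegMat (N i) A) ∧ F = pfaffDiff M N := by
  classical
  suffices h : ∀ H, ∃ N, (∀ i, IsSkew (N i)) ∧ (∀ i, DegMat (N i) A) ∧
      homogeneousComponent d (H * F) = pfaffDiff M N by
    have := h 1
    rwa [one_mul, homogeneousComponent_of_mem hF, if_pos rfl] at this
  clear hF
  induction hFM using Submodule.span_induction with
  | mem x hx =>
    intro H
    obtain ⟨i, e, rfl⟩ := Set.mem_iUnion.1 hx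
    obtain ⟨a, b, hab, ha, hb⟩ := exists_ne_ne_of_orderEmbedding e
    obtain ⟨u, hu0, hu⟩ := exists_pfaffCof_eq_smul (B := MvPolynomial σ ℂ) e hab ha hb
    obtain ⟨d', rfl, hd'⟩ := exists_isHomogeneous_pfaff_submatrix hsym hhom htr (hM i) e hab ha hb
    let g := C (2 * u)⁻¹ * homogeneousComponent (A a b) H
    have hg : g.IsHomogeneous (A a b) := IsHomogeneous.C_mul
      (homogeneousComponent_isHomogeneous _ _) _
    refine ⟨Pi.single i (Matrix.single a b g - Matrix.single b a g), fun j => ?_, fun j => ?_, ?_⟩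
    · obtain rfl | hij := eq_or_ne j i
      · intro p q
        simp only [Pi.single_eq_same, Matrix.sub_apply, Matrix.single_apply, neg_sub, and_comm]
      · intro p q
        simp [Pi.single_eq_of_ne hij]
    · obtain rfl | hij := eq_or_ne j i
      · intro p q
        simp only [Pi.single_eq_same, Matrix.sub_apply, Matrix.single_apply]
        refine IsHomogeneous.sub ?_ ?_
        · split_ifs with h
          · rwa [← h.1, ← h.2]
          · exact isHomogeneous_zero _ _ _
        · split_ifs with h
          · rwa [← h.1, ← h.2, hsym.apply]
          · exact isHomogeneous_zero _ _ _
      · intro p q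
        rw [Pi.single_eq_of_ne hij]
        exact isHomogeneous_zero _ _ _
    · refine (homogeneousComponent_mul_of_isHomogeneous H hd').trans ?_
      rw [pfaffDiff, Finset.sum_eq_single i (fun j _ hj => by simp [Pi.single_eq_of_ne hj])
        (by simp)]
      simp only [Pi.single_eq_same, Matrix.sub_apply, sub_mul, Finset.sum_sub_distrib,
        sum_sum_single_mul]
      rw [(hu (M i)).1, (hu (M i)).2, pfaff_eq_genPfaff]
      simp only [g, MvPolynomial.smul_eq_C_mul]
      have hC : C (2 * u)⁻¹ * (C 2 * C u) = (1 : MvPolynomial σ ℂ) := by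
        rw [← C_mul, ← C_mul, inv_mul_cancel₀ (by simpa using hu0), C_1]
      have h2 : (C 2 : MvPolynomial σ ℂ) = 2 := rfl
      rw [h2] at hC
      rw [C_neg]
      linear_combination -(homogeneousComponent (A a b) H * genPfaff ((M i).submatrix e e)) * hC
  | zero => exact fun H => ⟨0, by simp [IsSkew], fun i a b => isHomogeneous_zero _ _ _,
      by simp [pfaffDiff]⟩
  | add x y _ _ hx hy =>
    intro H
    obtain ⟨N, h1, h2, h3⟩ := hx H
    obtain ⟨N', h1', h2', h3'⟩ := hy H
    refine ⟨N + N', fun i a b => ?_, fun i a b => (h2 i a b).add (h2' i a b), ?_⟩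
    · simp [h1 i a b, h1' i a b, add_comm]
    · rw [mul_add, map_add, h3, h3', pfaffDiff_add]
  | smul r x _ hx =>
    intro H
    rw [smul_eq_mul, ← mul_assoc]
    exact hx _

end Differential

section Family

variable {σ κ ι : Type*}

theorem map_eval_commAlgEquiv (v : κ → ℂ) (p : MvPolynomial κ (MvPolynomial σ ℂ)) :
    MvPolynomial.map (eval v) (commAlgEquiv ℂ κ σ p) = eval (fun x => C (v x)) p := by
  induction p using MvPolynomial.induction_on with
  | C r =>
    rw [commAlgEquiv_C, eval_C, map_map]
    convert! MvPolynomial.map_id r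
    ext; simp
  | add p q hp hq => simp only [map_add, hp, hq]
  | mul_X p x hp => simp only [map_mul, hp, commAlgEquiv_X, map_C, eval_X]

theorem pderiv_coeff_commAlgEquiv (x : κ) (t : σ →₀ ℕ) (p : MvPolynomial κ (MvPolynomial σ ℂ)) :
    pderiv x (coeff t (commAlgEquiv ℂ κ σ p)) = coeff t (commAlgEquiv ℂ κ σ (pderiv x p)) := by
  classical
  induction p using MvPolynomial.induction_on with
  | C r => simp [commAlgEquiv_C, coeff_map]
  | add p q hp hq => simp only [map_add, coeff_add, hp, hq]
  | mul_X p y hp =>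
    rw [mul_comm p]
    simp only [map_mul, commAlgEquiv_X, coeff_C_mul, Derivation.leibniz, hp, pderiv_X, smul_eq_mul,
      map_add, coeff_add]
    obtain rfl | h := eq_or_ne y x
    · simp
    · simp [Pi.single_eq_of_ne h]

theorem exists_coeff_sum_pfaff [Fintype κ] [Fintype ι] {n : ℕ}
    (E : κ → ι → Matrix (Fin (2*n)) (Fin (2*n)) (MvPolynomial σ ℂ)) :
    ∃ Φ : (σ →₀ ℕ) → MvPolynomial κ ℂ, ∀ v t,
      eval v (Φ t) = coeff t (∑ i, pfaff ((∑ x, v x • E x) i)) ∧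
      ∀ x, eval v (pderiv x (Φ t)) = coeff t (pfaffDiff (∑ x, v x • E x) (E x)) := by
  classical
  let U : ι → Matrix (Fin (2*n)) (Fin (2*n)) (MvPolynomial κ (MvPolynomial σ ℂ)) :=
    fun i a b => ∑ x, X x * C (E x i a b)
  have hcoeff (v : κ → ℂ) (t : σ →₀ ℕ) (p : MvPolynomial κ (MvPolynomial σ ℂ)) :
      eval v (coeff t (commAlgEquiv ℂ κ σ p)) = coeff t (eval (fun x => C (v x)) p) := by
    rw [← map_eval_commAlgEquiv, coeff_map]
  let f (v : κ → ℂ) : MvPolynomial κ (MvPolynomial σ ℂ) →ₐ[ℂ] MvPolynomial σ ℂ :=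
    (aeval fun x => C (v x)).restrictScalars ℂ
  have hf (v : κ → ℂ) (p) : eval (fun x => C (v x)) p = f v p := by
    simp [f, aeval_eq_eval]
  have hfU (v : κ → ℂ) (i : ι) : (U i).map (f v) = (∑ x, v x • E x) i := by
    ext1 a b
    rw [Matrix.map_apply, ← hf]
    simp only [U, map_sum, map_mul, eval_X, eval_C, Finset.sum_apply, Matrix.sum_apply,
      Pi.smul_apply, Matrix.smul_apply, MvPolynomial.smul_eq_C_mul]
  refine ⟨fun t => coeff t (commAlgEquiv ℂ κ σ (∑ i, genPfaff (U i))), fun v t => ⟨?_, fun x => ?_⟩⟩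
  · rw [hcoeff, hf, map_sum]
    simp only [map_genPfaff, hfU, pfaff_eq_genPfaff]
  · rw [pderiv_coeff_commAlgEquiv, hcoeff, map_sum]
    simp only [derivation_genPfaff, pfaffDiff, hf, map_sum, map_mul, map_pfaffCof, hfU]
    have hU (i a b) : f v (pderiv x (U i a b)) = E x i a b := by
      simp only [U, map_sum, Derivation.leibniz, pderiv_X, pderiv_C, smul_zero, zero_add]
      rw [Finset.sum_eq_single x]
      · simp [← hf]
      · intro y _ hy
        simp [Pi.single_eq_of_ne hy]
      · simp
    simp only [hU]

end Family

section Parameters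

variable {σ ι m : Type*} [LinearOrder m]

/-- Indices of the coefficients above the diagonal of a family of skew-symmetric matrices of forms
with degree matrix `A`. -/
abbrev SkewIdx (σ ι : Type*) (A : Matrix m m ℕ) : Type _ :=
  {x : ι × m × m × (σ →₀ ℕ) // x.2.1 < x.2.2.1 ∧ x.2.2.2.degree = A x.2.1 x.2.2.1}

instance SkewIdx.finite [Finite σ] [Finite ι] [Finite m] (A : Matrix m m ℕ) :
    Finite (SkewIdx σ ι A) := by
  have h (c : ι × m × m) : Finite {t : σ →₀ ℕ // t.degree = A c.2.1 c.2.2} :=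
    Finsupp.finite_of_degree_eq _
  refine Finite.of_injective (β := Σ c : ι × m × m, {t : σ →₀ ℕ // t.degree = A c.2.1 c.2.2})
    (fun x => ⟨(x.1.1, x.1.2.1, x.1.2.2.1), x.1.2.2.2, x.2.2⟩) ?_
  rintro ⟨⟨i, a, b, t⟩, h1, h2⟩ ⟨⟨i', a', b', t'⟩, h1', h2'⟩ h
  simp only [Sigma.mk.injEq, Prod.mk.injEq] at h
  obtain ⟨⟨rfl, rfl, rfl⟩, h⟩ := h
  simpa using h

variable {A : Matrix m m ℕ}

open Classical in
/-- The family of skew-symmetric matrices having a single monomial above the diagonal. -/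
noncomputable def skewBasis (x : SkewIdx σ ι A) : ι → Matrix m m (MvPolynomial σ ℂ) :=
  fun i a b =>
    if i = x.1.1 ∧ a = x.1.2.1 ∧ b = x.1.2.2.1 then monomial x.1.2.2.2 1
    else if i = x.1.1 ∧ b = x.1.2.1 ∧ a = x.1.2.2.1 then - monomial x.1.2.2.2 1
    else 0

theorem isSkew_skewBasis (x : SkewIdx σ ι A) (i : ι) : IsSkew (skewBasis x i) := by
  intro a b
  have hx := x.2.1
  simp only [skewBasis]
  split_ifs with h1 h2 h2
  · rw [← h1.2.1, ← h1.2.2, h2.2.1, h2.2.2] at hx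
    exact (lt_asymm hx x.2.1).elim
  all_goals simp

theorem degMat_skewBasis (hsym : A.IsSymm) (x : SkewIdx σ ι A) (i : ι) :
    DegMat (skewBasis x i) A := by
  intro a b
  have hx : (monomial x.1.2.2.2 (1 : ℂ)).IsHomogeneous (A x.1.2.1 x.1.2.2.1) :=
    isHomogeneous_monomial _ x.2.2
  simp only [skewBasis]
  split_ifs with h1 h2
  · rwa [h1.2.1, h1.2.2]
  · rw [← hsym.apply, h2.2.1, h2.2.2]
    exact hx.neg
  · exact isHomogeneous_zero _ _ _

theorem coeff_skewBasis_self (x : SkewIdx σ ι A) :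
    coeff x.1.2.2.2 (skewBasis x x.1.1 x.1.2.1 x.1.2.2.1) = 1 := by
  classical
  rw [skewBasis, if_pos ⟨rfl, rfl, rfl⟩, coeff_monomial, if_pos rfl]

theorem coeff_skewBasis_of_ne {x y : SkewIdx σ ι A} (h : y ≠ x) :
    coeff x.1.2.2.2 (skewBasis y x.1.1 x.1.2.1 x.1.2.2.1) = 0 := by
  classical
  obtain ⟨⟨i, a, b, t⟩, h1, h2⟩ := x
  obtain ⟨⟨i', a', b', t'⟩, h1', h2'⟩ := y
  simp only [skewBasis]
  simp only [ne_eq, Subtype.mk.injEq, Prod.mk.injEq] at h h1 h1'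
  split_ifs with h3 h4
  · rw [coeff_monomial, if_neg]
    rintro rfl
    exact h ⟨h3.1.symm, h3.2.1.symm, h3.2.2.symm, rfl⟩
  · obtain ⟨-, rfl, rfl⟩ := h4
    exact (lt_asymm h1 h1').elim
  · simp

variable [Fintype (SkewIdx σ ι A)]

theorem isSkew_sum_skewBasis (v : SkewIdx σ ι A → ℂ) (i : ι) :
    IsSkew ((∑ x, v x • skewBasis x) i) := by
  intro a b
  simp only [Finset.sum_apply, Matrix.sum_apply, Pi.smul_apply, Matrix.smul_apply,
    isSkew_skewBasis _ i a b, smul_neg, Finset.sum_neg_distrib]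

theorem degMat_sum_skewBasis (hsym : A.IsSymm) (v : SkewIdx σ ι A → ℂ) (i : ι) :
    DegMat ((∑ x, v x • skewBasis x) i) A := by
  intro a b
  simp only [Finset.sum_apply, Matrix.sum_apply, Pi.smul_apply, Matrix.smul_apply,
    MvPolynomial.smul_eq_C_mul]
  exact IsHomogeneous.sum _ _ _ fun x _ => (degMat_skewBasis hsym x i a b).C_mul _

theorem coeff_sum_skewBasis (v : SkewIdx σ ι A → ℂ) (x : SkewIdx σ ι A) :
    coeff x.1.2.2.2 ((∑ y, v y • skewBasis y) x.1.1 x.1.2.1 x.1.2.2.1) = v x := by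
  simp only [Finset.sum_apply, Matrix.sum_apply, Pi.smul_apply, Matrix.smul_apply, coeff_sum,
    coeff_smul]
  rw [Finset.sum_eq_single x]
  · rw [coeff_skewBasis_self, smul_eq_mul, mul_one]
  · intro y _ hy
    rw [coeff_skewBasis_of_ne hy, smul_zero]
  · simp

theorem eq_sum_skewBasis (hsym : A.IsSymm) {M : ι → Matrix m m (MvPolynomial σ ℂ)}
    (hM : ∀ i, IsSkew (M i)) (hM' : ∀ i, DegMat (M i) A) :
    M = ∑ x : SkewIdx σ ι A, coeff x.1.2.2.2 (M x.1.1 x.1.2.1 x.1.2.2.1) • skewBasis x := by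
  set v : SkewIdx σ ι A → ℂ := fun x => coeff x.1.2.2.2 (M x.1.1 x.1.2.1 x.1.2.2.1) with hv
  have hlt (i : ι) (a b : m) (hab : a < b) : M i a b = (∑ x, v x • skewBasis x) i a b := by
    ext t
    by_cases ht : t.degree = A a b
    · exact (coeff_sum_skewBasis v ⟨(i, a, b, t), hab, ht⟩).symm
    · rw [(hM' i a b).coeff_eq_zero ht, (degMat_sum_skewBasis hsym v i a b).coeff_eq_zero ht]
  ext1 i
  ext1 a b
  rcases lt_trichotomy a b with hab | rfl | hab
  · exact hlt i a b hab
  · rw [self_eq_neg.1 (hM i a a), self_eq_neg.1 (isSkew_sum_skewBasis v i a a)]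
  · rw [hM i b a, isSkew_sum_skewBasis v i b a, hlt i b a hab]

end Parameters

section Forms

theorem MvPolynomial.eval_aeval {R T κ : Type*} [CommSemiring R] (v : κ → R)
    (g : T → MvPolynomial κ R) (p : MvPolynomial T R) :
    eval v (aeval g p) = eval (fun t => eval v (g t)) p := by
  induction p using MvPolynomial.induction_on with
  | C r => simp
  | add p q hp hq => simp only [map_add, hp, hq]
  | mul_X p x hp => simp only [map_mul, hp, aeval_X, eval_X]

variable {σ : Type*} {d : ℕ}

theorem MvPolynomial.IsHomogeneous.eq_of_coeff_eq {F G : MvPolynomial σ ℂ} (hF : F.IsHomogeneous d)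
    (hG : G.IsHomogeneous d) (h : ∀ t : {t : σ →₀ ℕ // t.degree = d}, coeff t.1 F = coeff t.1 G) :
    F = G := by
  ext t
  by_cases ht : t.degree = d
  · exact h ⟨t, ht⟩
  · rw [hF.coeff_eq_zero ht, hG.coeff_eq_zero ht]

theorem eval_coeff_eq_eval_aeval {F : MvPolynomial σ ℂ} (hF : F.IsHomogeneous d)
    (P : MvPolynomial (σ →₀ ℕ) ℂ) :
    eval (fun m => coeff m F) P =
      eval (fun t : {t : σ →₀ ℕ // t.degree = d} => coeff t.1 F)
        (aeval (fun m => if h : m.degree = d then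
          (X ⟨m, h⟩ : MvPolynomial {t : σ →₀ ℕ // t.degree = d} ℂ) else 0) P) := by
  rw [eval_aeval]
  congr 2
  funext m
  split_ifs with h
  · simp
  · rw [hF.coeff_eq_zero h, map_zero]

variable [Fintype {t : σ →₀ ℕ // t.degree = d}]

/-- The form of degree `d` with given coefficients. -/
noncomputable def formOf (y : {t : σ →₀ ℕ // t.degree = d} → ℂ) : MvPolynomial σ ℂ :=
  ∑ t, monomial t.1 (y t)

theorem isHomogeneous_formOf (y : {t : σ →₀ ℕ // t.degree = d} → ℂ) :
    (formOf y).IsHomogeneous d :=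
  IsHomogeneous.sum _ _ _ fun t _ => isHomogeneous_monomial _ t.2

theorem coeff_formOf (y : {t : σ →₀ ℕ // t.degree = d} → ℂ) (t : {t : σ →₀ ℕ // t.degree = d}) :
    coeff t.1 (formOf y) = y t := by
  classical
  simp only [formOf, coeff_sum, coeff_monomial, Subtype.val_inj, Finset.sum_ite_eq',
    Finset.mem_univ, if_true]

end Forms

section PfaffCoeff

variable {σ ι : Type*} [Finite σ] [Fintype ι] {n d : ℕ}

noncomputable instance SkewIdx.fintype {m : Type*} [Finite m] [LinearOrder m] (A : Matrix m m ℕ) :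
    Fintype (SkewIdx σ ι A) := Fintype.ofFinite _

noncomputable instance fintypeDegreeEq : Fintype {t : σ →₀ ℕ // t.degree = d} :=
  have : Finite {t : σ →₀ ℕ // t.degree = d} := Finsupp.finite_of_degree_eq _
  Fintype.ofFinite _

/-- The coefficient at `t` of the sum of the Pfaffians of a family of skew-symmetric matrices of
forms with degree matrix `A`, as a polynomial in the coefficients of these matrices. -/
noncomputable def pfaffCoeff (ι : Type*) [Fintype ι] (A : Matrix (Fin (2*n)) (Fin (2*n)) ℕ)
    (t : σ →₀ ℕ) : MvPolynomial (SkewIdx σ ι A) ℂ :=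
  (exists_coeff_sum_pfaff (skewBasis (σ := σ) (ι := ι) (A := A))).choose t

theorem eval_pfaffCoeff {A : Matrix (Fin (2*n)) (Fin (2*n)) ℕ} (v : SkewIdx σ ι A → ℂ)
    (t : σ →₀ ℕ) :
    eval v (pfaffCoeff ι A t) = coeff t (∑ i, pfaff ((∑ x, v x • skewBasis x) i)) :=
  ((exists_coeff_sum_pfaff (skewBasis (σ := σ) (ι := ι) (A := A))).choose_spec v t).1

theorem eval_pderiv_pfaffCoeff {A : Matrix (Fin (2*n)) (Fin (2*n)) ℕ} (v : SkewIdx σ ι A → ℂ)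
    (t : σ →₀ ℕ) (x : SkewIdx σ ι A) :
    eval v (pderiv x (pfaffCoeff ι A t)) =
      coeff t (pfaffDiff (∑ y, v y • skewBasis y) (skewBasis x)) :=
  ((exists_coeff_sum_pfaff (skewBasis (σ := σ) (ι := ι) (A := A))).choose_spec v t).2 x

theorem sum_mul_eval_pderiv_pfaffCoeff {A : Matrix (Fin (2*n)) (Fin (2*n)) ℕ}
    (v w : SkewIdx σ ι A → ℂ) (t : σ →₀ ℕ) :
    ∑ x, w x * eval v (pderiv x (pfaffCoeff ι A t)) =
      coeff t (pfaffDiff (∑ y, v y • skewBasis y) (∑ y, w y • skewBasis y)) := by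
  simp only [eval_pderiv_pfaffCoeff, pfaffDiff_sum, pfaffDiff_smul, coeff_sum, coeff_smul,
    smul_eq_mul]

theorem algebraicIndependent_pfaffCoeff_iff_general_form
    {A : Matrix (Fin (2*n)) (Fin (2*n)) ℕ} (hsym : A.IsSymm) (hhom : HomogMat A)
    (htr : A.trace = 2 * d) :
    AlgebraicIndependent ℂ (fun t : {t : σ →₀ ℕ // t.degree = d} => pfaffCoeff ι A t.1) ↔
    ∃ P : MvPolynomial (σ →₀ ℕ) ℂ, P ≠ 0 ∧
      (∃ F : MvPolynomial σ ℂ, F.IsHomogeneous d ∧ eval (fun m => coeff m F) P ≠ 0) ∧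
      ∀ F : MvPolynomial σ ℂ, F.IsHomogeneous d → eval (fun m => coeff m F) P ≠ 0 →
        ∃ M : ι → Matrix (Fin (2*n)) (Fin (2*n)) (MvPolynomial σ ℂ),
          (∀ i, IsSkew (M i)) ∧ (∀ i, DegMat (M i) A) ∧ F = ∑ i, pfaff (M i) := by
  constructor
  · intro h
    obtain ⟨p, hp0, hp⟩ := h.exists_ne_zero_forall_exists_eval_eq
    have hev (F : MvPolynomial σ ℂ) : eval (fun m => coeff m F) (rename Subtype.val p) =
        eval (fun t : {t : σ →₀ ℕ // t.degree = d} => coeff t.1 F) p := by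
      rw [eval_rename]
      rfl
    refine ⟨rename Subtype.val p, ?_, ?_, fun F hF hFp => ?_⟩
    · rwa [ne_eq, (rename_injective _ Subtype.val_injective).eq_iff' (map_zero _)]
    · obtain ⟨y, hy⟩ : ∃ y, eval y p ≠ 0 := by
        by_contra! hy
        exact hp0 (MvPolynomial.funext fun y => by rw [hy, map_zero])
      refine ⟨formOf y, isHomogeneous_formOf y, ?_⟩
      simpa only [hev, coeff_formOf] using hy
    · obtain ⟨v, hv⟩ := hp _ (hev F ▸ hFp)
      refine ⟨_, isSkew_sum_skewBasis v, degMat_sum_skewBasis hsym v, ?_⟩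
      refine IsHomogeneous.eq_of_coeff_eq hF (IsHomogeneous.sum _ _ _ fun i _ =>
        isHomogeneous_pfaff hsym hhom htr (degMat_sum_skewBasis hsym v i)) fun t => ?_
      rw [← hv t, eval_pfaffCoeff]
  · rintro ⟨P, -, ⟨F₀, hF₀, hPF₀⟩, hP⟩
    rw [algebraicIndependent_iff]
    intro G hG
    by_contra hG0
    rw [eval_coeff_eq_eval_aeval hF₀] at hPF₀
    set p := aeval (fun m => if h : m.degree = d then
          (X ⟨m, h⟩ : MvPolynomial {t : σ →₀ ℕ // t.degree = d} ℂ) else 0) P with hp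
    have hp0 : p ≠ 0 := fun h => hPF₀ (by rw [h, map_zero])
    obtain ⟨y, hy⟩ : ∃ y, eval y (p * G) ≠ 0 := by
      by_contra! hy
      exact mul_ne_zero hp0 hG0 (MvPolynomial.funext fun y => by rw [hy, map_zero])
    rw [map_mul] at hy
    have hPy : eval (fun m => coeff m (formOf y)) P ≠ 0 := by
      rw [eval_coeff_eq_eval_aeval (isHomogeneous_formOf y)]
      simpa only [coeff_formOf] using left_ne_zero_of_mul hy
    obtain ⟨M, hM, hMA, hFM⟩ := hP _ (isHomogeneous_formOf y) hPy
    rw [eq_sum_skewBasis hsym hM hMA] at hFM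
    have hyv := fun t => (coeff_formOf y t).symm.trans
      ((congrArg (coeff t.1) hFM).trans (eval_pfaffCoeff _ _).symm)
    refine right_ne_zero_of_mul hy ?_
    rw [funext hyv]
    rw [← eval_aeval, hG, map_zero]

theorem algebraicIndependent_pfaffCoeff_iff_general_span
    {A : Matrix (Fin (2*(n+1))) (Fin (2*(n+1))) ℕ} (hsym : A.IsSymm) (hhom : HomogMat A)
    (htr : A.trace = 2 * d) :
    AlgebraicIndependent ℂ (fun t : {t : σ →₀ ℕ // t.degree = d} => pfaffCoeff ι A t.1) ↔
    ∃ Q : MvPolynomial (ι × Fin (2*(n+1)) × Fin (2*(n+1)) × (σ →₀ ℕ)) ℂ, Q ≠ 0 ∧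
      (∃ M : ι → Matrix (Fin (2*(n+1))) (Fin (2*(n+1))) (MvPolynomial σ ℂ),
        (∀ i, IsSkew (M i)) ∧ (∀ i, DegMat (M i) A) ∧
        eval (fun x => coeff x.2.2.2 (M x.1 x.2.1 x.2.2.1)) Q ≠ 0) ∧
      ∀ M : ι → Matrix (Fin (2*(n+1))) (Fin (2*(n+1))) (MvPolynomial σ ℂ),
        (∀ i, IsSkew (M i)) → (∀ i, DegMat (M i) A) →
        eval (fun x => coeff x.2.2.2 (M x.1 x.2.1 x.2.2.1)) Q ≠ 0 →
        ∀ F : MvPolynomial σ ℂ, F.IsHomogeneous d →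
          F ∈ Ideal.span (⋃ i, submaxPfEven (M i)) := by
  classical
  constructor
  · intro h
    obtain ⟨q, B, hq0, hB⟩ := h.exists_jacobian_right_inverse
    have hev (M : ι → Matrix (Fin (2*(n+1))) (Fin (2*(n+1))) (MvPolynomial σ ℂ)) :
        eval (fun x => coeff x.2.2.2 (M x.1 x.2.1 x.2.2.1)) (rename Subtype.val q) =
        eval (fun x : SkewIdx σ ι A => coeff x.1.2.2.2 (M x.1.1 x.1.2.1 x.1.2.2.1)) q := by
      rw [eval_rename]
      rfl
    refine ⟨rename Subtype.val q, ?_, ?_, fun M hM hMA hMq F hF => ?_⟩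
    · rwa [ne_eq, (rename_injective _ Subtype.val_injective).eq_iff' (map_zero _)]
    · obtain ⟨v, hv⟩ : ∃ v, eval v q ≠ 0 := by
        by_contra! hv
        exact hq0 (MvPolynomial.funext fun v => by rw [hv, map_zero])
      refine ⟨_, isSkew_sum_skewBasis v, degMat_sum_skewBasis hsym v, ?_⟩
      rw [hev]
      simpa only [coeff_sum_skewBasis] using hv
    · rw [hev] at hMq
      obtain ⟨v, hv⟩ : ∃ v, v = fun x : SkewIdx σ ι A =>
        coeff x.1.2.2.2 (M x.1.1 x.1.2.1 x.1.2.2.1) := ⟨_, rfl⟩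
      have hMv : M = ∑ x, v x • skewBasis x := by
        rw [hv]
        exact eq_sum_skewBasis hsym hM hMA
      rw [← hv] at hMq
      let w : SkewIdx σ ι A → ℂ := fun x =>
        ∑ t : {t : σ →₀ ℕ // t.degree = d}, coeff t.1 F * eval v (B t x) / eval v q
      suffices hF' : F = pfaffDiff M (∑ x, w x • skewBasis x) by
        rw [hF']
        exact pfaffDiff_mem_span _ _
      refine IsHomogeneous.eq_of_coeff_eq hF (isHomogeneous_pfaffDiff hsym hhom htr hMA
        (degMat_sum_skewBasis hsym w)) fun t => ?_
      rw [hMv, ← sum_mul_eval_pderiv_pfaffCoeff]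
      simp only [w, Finset.sum_mul]
      rw [Finset.sum_comm, Finset.sum_eq_single t]
      · have := congrArg (eval v) (hB t t)
        simp only [map_sum, map_mul, if_true] at this
        simp only [mul_div_right_comm _ (eval v (B t _)), mul_assoc, ← Finset.mul_sum, this]
        exact (div_mul_cancel₀ _ hMq).symm
      · intro t' _ ht'
        have := congrArg (eval v) (hB t' t)
        simp only [map_sum, map_mul, if_neg ht', map_zero] at this
        simp only [mul_div_right_comm _ (eval v (B t' _)), mul_assoc, ← Finset.mul_sum, this,
          mul_zero]
      · simp
  · rintro ⟨Q, -, ⟨M, hM, hMA, hMQ⟩, hQ⟩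
    have hN (t : {t : σ →₀ ℕ // t.degree = d}) : ∃ w : SkewIdx σ ι A → ℂ,
        monomial t.1 1 = pfaffDiff M (∑ x, w x • skewBasis x) := by
      have ht : (monomial t.1 (1 : ℂ)).IsHomogeneous d := isHomogeneous_monomial _ t.2
      obtain ⟨N, hN, hNA, h⟩ := exists_pfaffDiff_eq_of_mem_span hsym hhom htr hMA ht
        (hQ M hM hMA hMQ _ ht)
      exact ⟨_, by rw [h, ← eq_sum_skewBasis hsym hN hNA]⟩
    choose w hw using hN
    have hMv := eq_sum_skewBasis hsym hM hMA
    refine algebraicIndependent_of_jacobian _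
      (fun x : SkewIdx σ ι A => coeff x.1.2.2.2 (M x.1.1 x.1.2.1 x.1.2.2.1)) w fun t t' => ?_
    rw [sum_mul_eval_pderiv_pfaffCoeff, ← hMv, ← hw, coeff_monomial]
    simp only [Subtype.val_inj]

end PfaffCoeff

/-- Fix a `2k × 2k` symmetric homogeneous non-negative integer matrix
`A` with `tr A = 2d`, and `n+1` variables. The following are equivalent:
(i) a general form of degree `d` is the sum of `s` Pfaffians of skew-symmetric matrices
of forms with degree matrix `A`;
(ii) for a general choice of `s` skew-symmetric matrices of forms with degree matrix `A`,
the ideal generated by the submaximal Pfaffians of all of them contains every form of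
degree `d`. In both cases genericity is expressed by a nonzero polynomial in the
coefficients, cutting out a nonempty Zariski-open subset of the parameter space. -/
theorem general_form_sum_of_pfaffians_iff_submax_pfaffians_fill_degree
    (n k s d : ℕ) (hk : 0 < k) (hs : 0 < s)
    (A : Matrix (Fin (2*k)) (Fin (2*k)) ℕ) (hsym : A.IsSymm) (hhom : HomogMat A)
    (htr : Matrix.trace A = 2 * d) :
    (∃ P : MvPolynomial ((Fin (n+1)) →₀ ℕ) ℂ, P ≠ 0 ∧
      (∃ F : MvPolynomial (Fin (n+1)) ℂ, F.IsHomogeneous d ∧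
        MvPolynomial.eval (fun m => MvPolynomial.coeff m F) P ≠ 0) ∧
      ∀ F : MvPolynomial (Fin (n+1)) ℂ, F.IsHomogeneous d →
        MvPolynomial.eval (fun m => MvPolynomial.coeff m F) P ≠ 0 →
        ∃ M : Fin s → Matrix (Fin (2*k)) (Fin (2*k)) (MvPolynomial (Fin (n+1)) ℂ),
          (∀ i, IsSkew (M i)) ∧ (∀ i, DegMat (M i) A) ∧
          F = ∑ i, pfaff (M i))
    ↔
    (∃ Q : MvPolynomial (Fin s × Fin (2*k) × Fin (2*k) × ((Fin (n+1)) →₀ ℕ)) ℂ, Q ≠ 0 ∧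
      (∃ M : Fin s → Matrix (Fin (2*k)) (Fin (2*k)) (MvPolynomial (Fin (n+1)) ℂ),
        (∀ i, IsSkew (M i)) ∧ (∀ i, DegMat (M i) A) ∧
        MvPolynomial.eval
          (fun x => MvPolynomial.coeff x.2.2.2 (M x.1 x.2.1 x.2.2.1)) Q ≠ 0) ∧
      ∀ M : Fin s → Matrix (Fin (2*k)) (Fin (2*k)) (MvPolynomial (Fin (n+1)) ℂ),
        (∀ i, IsSkew (M i)) → (∀ i, DegMat (M i) A) →
        MvPolynomial.eval
          (fun x => MvPolynomial.coeff x.2.2.2 (M x.1 x.2.1 x.2.2.1)) Q ≠ 0 →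
        ∀ F : MvPolynomial (Fin (n+1)) ℂ, F.IsHomogeneous d →
          F ∈ Ideal.span (⋃ i, submaxPfEven (M i))) := by
  obtain ⟨k, rfl⟩ := Nat.exists_eq_add_of_le' hk
  exact (algebraicIndependent_pfaffCoeff_iff_general_form hsym hhom htr).symm.trans
    (algebraicIndependent_pfaffCoeff_iff_general_span hsym hhom htr)
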